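/- Let ε, μ > 0 and β ∈ ℝ, β ≠ 0. Define S₀(s) = Σ_{j=0}^{∞} (−s)^j/(j!)² and S₁(s) = Σ_{j=0}^{∞} (−s)^j/(j!(j+1)!) for s ∈ ℝ, and for t > 0, x ∈ ℝ³∖{0} set s(t,x) = t|x|/(β²√(εμ)) and f(t,x) = (e^{it/(β√(εμ))}/(β√(εμ))) · [ 𝒦_{1/β}(x) S₀(s(t,x)) + (i t/(β²√(εμ))) Θ_{1/β}(x) (1 − i x/|x|) S₁(s(t,x)) ], where Θ_{1/β}(x) = −e^{i|x|/β}/(4π|x|) and 𝒦_{1/β}(x) = (1/β + x/|x|² − (i/β) x/|x|) Θ_{1/β}(x). Then f satisfies M f(t,x) = β√(εμ) ∂ₜ D f + √(εμ) ∂ₜ f − iD f = 0 for all t > 0 and x ∈ ℝ³∖{0}. -/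

import Mathlib

noncomputable section

/-- Points of `ℝ³`. -/
abbrev V3 : Type := Fin 3 → ℝ

/-- Biquaternions `ℍ[ℂ]`: quaternions with complex coefficients. -/
abbrev BQ : Type := Quaternion ℂ

/-- Euclidean norm on `ℝ³`. -/
def enorm3 (x : V3) : ℝ := Real.sqrt (x 0 ^ 2 + x 1 ^ 2 + x 2 ^ 2)

/-- Spatial partial derivative of a real-valued function. -/
def pdR (k : Fin 3) (g : V3 → ℝ) (x : V3) : ℝ := fderiv ℝ g x (Pi.single k 1)

/-- Spatial partial derivative of a complex-valued function. -/
def pdC (k : Fin 3) (g : V3 → ℂ) (x : V3) : ℂ := fderiv ℝ g x (Pi.single k 1)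

/-- Divergence (in the space variables) of a time-dependent vector field. -/
def div3 (E : ℝ × V3 → V3) (p : ℝ × V3) : ℝ :=
  ∑ k : Fin 3, pdR k (fun y => E (p.1, y) k) p.2

/-- Curl (in the space variables) of a time-dependent vector field. -/
def rot3 (E : ℝ × V3 → V3) (p : ℝ × V3) : V3 :=
  ![pdR 1 (fun y => E (p.1, y) 2) p.2 - pdR 2 (fun y => E (p.1, y) 1) p.2,
    pdR 2 (fun y => E (p.1, y) 0) p.2 - pdR 0 (fun y => E (p.1, y) 2) p.2,
    pdR 0 (fun y => E (p.1, y) 1) p.2 - pdR 1 (fun y => E (p.1, y) 0) p.2]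

/-- Time derivative of a vector field. -/
def ptV (E : ℝ × V3 → V3) (p : ℝ × V3) : V3 := deriv (fun s => E (s, p.2)) p.1

/-- Time derivative of a scalar (real-valued) function. -/
def ptR (ρ : ℝ × V3 → ℝ) (p : ℝ × V3) : ℝ := deriv (fun s => ρ (s, p.2)) p.1

/-- Build a biquaternion from a complex scalar part and a complex vector part. -/
def bq (s : ℂ) (v : Fin 3 → ℂ) : BQ := ⟨s, v 0, v 1, v 2⟩

/-- A complex vector as a purely vectorial biquaternion. -/
def vecC (v : Fin 3 → ℂ) : BQ := bq 0 v

/-- A real vector as a purely vectorial biquaternion. -/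
def vecR (v : V3) : BQ := vecC (fun k => (v k : ℂ))

/-- The basic quaternionic imaginary units `i₁, i₂, i₃`. -/
def qi : Fin 3 → BQ := ![⟨0,1,0,0⟩, ⟨0,0,1,0⟩, ⟨0,0,0,1⟩]

/-- Componentwise spatial partial derivative of a biquaternion-valued function. -/
def pdQ (k : Fin 3) (F : V3 → BQ) (x : V3) : BQ :=
  ⟨pdC k (fun y => (F y).re) x, pdC k (fun y => (F y).imI) x,
   pdC k (fun y => (F y).imJ) x, pdC k (fun y => (F y).imK) x⟩

/-- The Moisil–Teodoresco operator `D F = i₁ ∂₁F + i₂ ∂₂F + i₃ ∂₃F`. -/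
def Dop (F : V3 → BQ) (x : V3) : BQ :=
  qi 0 * pdQ 0 F x + qi 1 * pdQ 1 F x + qi 2 * pdQ 2 F x

/-- The Moisil–Teodoresco operator acting in the space variables. -/
def DQ (F : ℝ × V3 → BQ) (p : ℝ × V3) : BQ := Dop (fun y => F (p.1, y)) p.2

/-- Componentwise time derivative of a biquaternion-valued function. -/
def ptQ (F : ℝ × V3 → BQ) (p : ℝ × V3) : BQ :=
  ⟨deriv (fun s => (F (s, p.2)).re) p.1, deriv (fun s => (F (s, p.2)).imI) p.1,
   deriv (fun s => (F (s, p.2)).imJ) p.1, deriv (fun s => (F (s, p.2)).imK) p.1⟩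

/-- The operator `M = β√(εμ) ∂ₜ D + √(εμ) ∂ₜ − iD`. -/
def Mop (ε μ β : ℝ) (F : ℝ × V3 → BQ) (p : ℝ × V3) : BQ :=
  ((β * Real.sqrt (ε * μ) : ℝ) : ℂ) • ptQ (DQ F) p
    + ((Real.sqrt (ε * μ) : ℝ) : ℂ) • ptQ F p
    - Complex.I • DQ F p

/-- The complex conjugate operator `M* = β√(εμ) ∂ₜ D + √(εμ) ∂ₜ + iD`. -/
def MstarOp (ε μ β : ℝ) (F : ℝ × V3 → BQ) (p : ℝ × V3) : BQ :=
  ((β * Real.sqrt (ε * μ) : ℝ) : ℂ) • ptQ (DQ F) p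
    + ((Real.sqrt (ε * μ) : ℝ) : ℂ) • ptQ F p
    + Complex.I • DQ F p

/-- `C^n` smoothness of a biquaternion-valued function, componentwise. -/
def ContDiffQ (n : ℕ∞) (F : ℝ × V3 → BQ) : Prop :=
  ContDiff ℝ n (fun p => (F p).re) ∧ ContDiff ℝ n (fun p => (F p).imI) ∧
  ContDiff ℝ n (fun p => (F p).imJ) ∧ ContDiff ℝ n (fun p => (F p).imK)

/-- `Θ_α(x) = −e^{iα|x|}/(4π|x|)`. -/
def Theta (α : ℂ) (x : V3) : ℂ :=
  -Complex.exp (Complex.I * α * (enorm3 x : ℝ)) / (4 * Real.pi * (enorm3 x : ℝ))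

/-- `𝒦_α(x) = (α + x/|x|² − iα x/|x|) Θ_α(x)`. -/
def Kfun (α : ℂ) (x : V3) : BQ :=
  Theta α x • ((α : BQ) + (((enorm3 x ^ 2)⁻¹ : ℝ) : ℂ) • vecR x
    - (Complex.I * α * ((enorm3 x : ℝ) : ℂ)⁻¹) • vecR x)


/-- `S₀(s) = Σ_{j≥0} (−s)^j/(j!)²`, so that `S₀(s) = J₀(2√s)`. -/
def S0 (s : ℝ) : ℝ := ∑' j : ℕ, (-s) ^ j / ((Nat.factorial j : ℝ)) ^ 2

/-- `S₁(s) = Σ_{j≥0} (−s)^j/(j!(j+1)!)`, so that `s S₁(s) = √s J₁(2√s)`. -/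
def S1 (s : ℝ) : ℝ :=
  ∑' j : ℕ, (-s) ^ j / ((Nat.factorial j : ℝ) * (Nat.factorial (j + 1) : ℝ))

lemma aux_summ (a : ℕ → ℝ) (ha : ∀ j, |a j| ≤ ((Nat.factorial j : ℝ))⁻¹) (s : ℝ) :
    Summable (fun j => a j * s ^ j) := by
  refine Summable.of_norm_bounded (Real.summable_pow_div_factorial |s|) ?_
  intro j
  rw [Real.norm_eq_abs, abs_mul, abs_pow, div_eq_mul_inv, mul_comm]
  exact mul_le_mul_of_nonneg_left (ha j) (by positivity)

lemma aux_deriv (a : ℕ → ℝ) (ha : ∀ j, |a j| ≤ ((Nat.factorial j : ℝ))⁻¹) (s : ℝ) :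
    HasDerivAt (fun s => ∑' j : ℕ, a j * s ^ j) (∑' j : ℕ, a j * (j * s ^ (j - 1))) s := by
  set R : ℝ := |s| + 1 with hR
  have hu : Summable (fun j : ℕ => R ^ (j - 1) * j / (Nat.factorial j : ℝ)) := by
    rw [← summable_nat_add_iff 1]
    refine (Real.summable_pow_div_factorial R).congr ?_
    intro j
    rw [Nat.factorial_succ]
    push_cast
    have : (j : ℝ) + 1 ≠ 0 := by positivity
    have h2 : (Nat.factorial j : ℝ) ≠ 0 := by positivity
    field_simp
  refine hasDerivAt_tsum_of_isPreconnected (t := Metric.ball 0 R) (y₀ := 0) hu Metric.isOpen_ball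
    (convex_ball _ _).isPreconnected (g := fun j s => a j * s ^ j)
    (g' := fun j s => a j * (j * s ^ (j - 1))) ?_ ?_ ?_ (aux_summ a ha 0) ?_
  · intro j y _
    exact (hasDerivAt_pow j y).const_mul (a j)
  · intro j y hy
    have hy' : |y| ≤ R := by
      have := mem_ball_zero_iff.1 hy
      rw [Real.norm_eq_abs] at this
      exact this.le
    rw [Real.norm_eq_abs, abs_mul, abs_mul, abs_pow, Nat.abs_cast, div_eq_mul_inv, mul_comm]
    have h1 : |y| ^ (j - 1) ≤ R ^ (j - 1) := pow_le_pow_left₀ (abs_nonneg _) hy' _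
    rw [mul_comm (j : ℝ)]
    exact mul_le_mul (mul_le_mul_of_nonneg_right h1 (by positivity)) (ha j) (abs_nonneg _)
      (by positivity)
  · rw [mem_ball_zero_iff, norm_zero]; positivity
  · rw [mem_ball_zero_iff, Real.norm_eq_abs]; linarith

def a0 (j : ℕ) : ℝ := (-1) ^ j / ((Nat.factorial j : ℝ)) ^ 2
def a1 (j : ℕ) : ℝ := (-1) ^ j / ((Nat.factorial j : ℝ) * (Nat.factorial (j + 1) : ℝ))

lemma one_le_fac (j : ℕ) : (1 : ℝ) ≤ Nat.factorial j := by
  exact_mod_cast Nat.factorial_pos j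

lemma a0_bd (j : ℕ) : |a0 j| ≤ ((Nat.factorial j : ℝ))⁻¹ := by
  have h := one_le_fac j
  rw [a0, abs_div, abs_pow, abs_neg, abs_one, one_pow, one_div, abs_of_nonneg (by positivity)]
  apply inv_anti₀ (by positivity)
  nlinarith

lemma a1_bd (j : ℕ) : |a1 j| ≤ ((Nat.factorial j : ℝ))⁻¹ := by
  have h := one_le_fac j
  have h := one_le_fac (j + 1)
  rw [a1, abs_div, abs_pow, abs_neg, abs_one, one_pow, one_div, abs_of_nonneg (by positivity)]
  apply inv_anti₀ (by positivity)
  nlinarith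

lemma S0_eq : S0 = fun s => ∑' j : ℕ, a0 j * s ^ j := by
  funext s
  rw [S0]
  refine tsum_congr fun j => ?_
  rw [a0, neg_pow]; ring

lemma S1_eq : S1 = fun s => ∑' j : ℕ, a1 j * s ^ j := by
  funext s
  rw [S1]
  refine tsum_congr fun j => ?_
  rw [a1, neg_pow]; ring

lemma S0_deriv (s : ℝ) : HasDerivAt S0 (-S1 s) s := by
  rw [S0_eq]
  convert aux_deriv a0 a0_bd s using 1
  rw [S1_eq, tsum_eq_zero_add']
  · simp only [Nat.cast_zero, zero_mul, mul_zero, zero_add, ← tsum_neg]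
    refine tsum_congr fun j => ?_
    rw [a0, a1, Nat.factorial_succ, Nat.add_sub_cancel]
    have : (j : ℝ) + 1 ≠ 0 := by positivity
    have h2 : (Nat.factorial j : ℝ) ≠ 0 := by positivity
    push_cast
    field_simp
    ring
  · refine (aux_summ a1 a1_bd s).neg.congr fun j => ?_
    rw [a0, a1, Nat.factorial_succ, Nat.add_sub_cancel]
    have : (j : ℝ) + 1 ≠ 0 := by positivity
    have h2 : (Nat.factorial j : ℝ) ≠ 0 := by positivity
    push_cast
    field_simp
    ring

lemma S1_deriv (s : ℝ) : ∃ d, HasDerivAt S1 d s ∧ s * d = S0 s - S1 s := by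
  refine ⟨_, S1_eq ▸ aux_deriv a1 a1_bd s, ?_⟩
  rw [S0_eq, S1_eq]
  simp only
  rw [← (aux_summ a0 a0_bd s).tsum_sub (aux_summ a1 a1_bd s), ← tsum_mul_left]
  refine tsum_congr fun j => ?_
  rw [a0, a1]
  rcases j with _ | j
  · simp
  · rw [Nat.factorial_succ (j + 1), Nat.add_sub_cancel]
    have : ((j + 1 : ℕ) : ℝ) + 1 ≠ 0 := by positivity
    have h2 : (Nat.factorial (j + 1) : ℝ) ≠ 0 := by positivity
    push_cast at this ⊢
    field_simp
    ring

lemma enorm3_pos {x : V3} (hx : x ≠ 0) : 0 < enorm3 x := by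
  apply Real.sqrt_pos.2
  by_contra h
  apply hx
  have h0 : x 0 = 0 := by nlinarith [sq_nonneg (x 0), sq_nonneg (x 1), sq_nonneg (x 2)]
  have h1 : x 1 = 0 := by nlinarith [sq_nonneg (x 0), sq_nonneg (x 1), sq_nonneg (x 2)]
  have h2 : x 2 = 0 := by nlinarith [sq_nonneg (x 0), sq_nonneg (x 1), sq_nonneg (x 2)]
  funext k
  fin_cases k
  · exact h0
  · exact h1
  · exact h2

lemma enorm3_sq (x : V3) : enorm3 x ^ 2 = x 0 ^ 2 + x 1 ^ 2 + x 2 ^ 2 :=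
  Real.sq_sqrt (by positivity)

lemma enorm3_fderiv {x : V3} (hx : x ≠ 0) : ∃ L : V3 →L[ℝ] ℝ, HasFDerivAt enorm3 L x ∧
    ∀ k, L (Pi.single k 1) = x k / enorm3 x := by
  have hr := enorm3_pos hx
  have hp : ∀ k : Fin 3, HasFDerivAt (fun y : V3 => y k)
      (ContinuousLinearMap.proj (R := ℝ) (φ := fun _ : Fin 3 => ℝ) k) x := fun k =>
    (ContinuousLinearMap.proj (R := ℝ) (φ := fun _ : Fin 3 => ℝ) k).hasFDerivAt
  have h := ((((hp 0).pow 2).add ((hp 1).pow 2)).add ((hp 2).pow 2)).sqrt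
    (by have := enorm3_sq x; simp only [Pi.add_apply]; nlinarith)
  refine ⟨_, h, ?_⟩
  intro k
  fin_cases k <;> simp [enorm3] <;> field_simp

lemma pd_radial {x : V3} (hx : x ≠ 0) (G : ℝ → ℂ) (G' : ℂ) (hG : HasDerivAt G G' (enorm3 x))
    (k : Fin 3) : pdC k (fun y => G (enorm3 y)) x = G' * (x k / enorm3 x : ℝ) := by
  obtain ⟨L, hL, hk⟩ := enorm3_fderiv hx
  have h := hG.hasFDerivAt.comp x hL
  rw [pdC]
  have h2 : fderiv ℝ (fun y => G (enorm3 y)) x = _ := h.fderiv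
  rw [h2]
  simp [hk, mul_comm]

lemma pd_radial_mul {x : V3} (hx : x ≠ 0) (G : ℝ → ℂ) (G' : ℂ) (hG : HasDerivAt G G' (enorm3 x))
    (k j : Fin 3) : pdC k (fun y => G (enorm3 y) * (y j : ℂ)) x
      = G' * (x k / enorm3 x : ℝ) * x j + G (enorm3 x) * (if j = k then 1 else 0) := by
  obtain ⟨L, hL, hk⟩ := enorm3_fderiv hx
  have h := hG.hasFDerivAt.comp x hL
  have hj : HasFDerivAt (fun y : V3 => (y j : ℂ)) (Complex.ofRealCLM.comp
      (ContinuousLinearMap.proj (R := ℝ) (φ := fun _ : Fin 3 => ℝ) j)) x :=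
    (Complex.ofRealCLM.comp
      (ContinuousLinearMap.proj (R := ℝ) (φ := fun _ : Fin 3 => ℝ) j)).hasFDerivAt
  rw [pdC]
  have h2 : fderiv ℝ (fun y => G (enorm3 y) * (y j : ℂ)) x = _ := (h.mul hj).fderiv
  rw [h2]
  by_cases hjk : j = k
  · subst hjk
    simp [hk]; ring
  · simp [hk, hjk]; ring

def mk4 (a b c d : ℂ) : BQ := ⟨a, b, c, d⟩

lemma mk4_add (a b c d e f g h : ℂ) :
    mk4 a b c d + mk4 e f g h = mk4 (a + e) (b + f) (c + g) (d + h) := rfl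

lemma mk4_sub (a b c d e f g h : ℂ) :
    mk4 a b c d - mk4 e f g h = mk4 (a - e) (b - f) (c - g) (d - h) := rfl

lemma mk4_smul (z a b c d : ℂ) : z • mk4 a b c d = mk4 (z * a) (z * b) (z * c) (z * d) := rfl

lemma mk4_one : (1 : BQ) = mk4 1 0 0 0 := rfl

lemma mk4_zero : (0 : BQ) = mk4 0 0 0 0 := rfl

lemma mk4_coe (z : ℂ) : (z : BQ) = mk4 z 0 0 0 := rfl

lemma mk4_vecR (x : V3) : vecR x = mk4 0 (x 0) (x 1) (x 2) := rfl

lemma mk4_congr {a b c d e f g h : ℂ} (h1 : a = e) (h2 : b = f) (h3 : c = g) (h4 : d = h) :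
    mk4 a b c d = mk4 e f g h := by rw [h1, h2, h3, h4]

lemma mk4_mul (a b c d e f g h : ℂ) :
    mk4 a b c d * mk4 e f g h = mk4 (a * e - b * f - c * g - d * h)
      (a * f + b * e + c * h - d * g) (a * g - b * h + c * e + d * f)
      (a * h + b * g - c * f + d * e) :=
  QuaternionAlgebra.ext (Quaternion.re_mul (mk4 a b c d) (mk4 e f g h))
    (Quaternion.imI_mul (mk4 a b c d) (mk4 e f g h))
    (Quaternion.imJ_mul (mk4 a b c d) (mk4 e f g h))
    (Quaternion.imK_mul (mk4 a b c d) (mk4 e f g h))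

lemma qi0 : qi 0 = mk4 0 1 0 0 := rfl
lemma qi1 : qi 1 = mk4 0 0 1 0 := rfl
lemma qi2 : qi 2 = mk4 0 0 0 1 := rfl

lemma pdQ_mk4 (k : Fin 3) (A B C D : V3 → ℂ) (x : V3) :
    pdQ k (fun y => mk4 (A y) (B y) (C y) (D y)) x =
      mk4 (pdC k A x) (pdC k B x) (pdC k C x) (pdC k D x) := rfl

lemma Dop_radial {x : V3} (hx : x ≠ 0) (A B : ℝ → ℂ) (A' B' : ℂ)
    (hA : HasDerivAt A A' (enorm3 x)) (hB : HasDerivAt B B' (enorm3 x)) :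
    Dop (fun y => mk4 (A (enorm3 y)) (B (enorm3 y) * (y 0 : ℂ)) (B (enorm3 y) * (y 1 : ℂ))
      (B (enorm3 y) * (y 2 : ℂ))) x =
    mk4 (-(enorm3 x * B' + 3 * B (enorm3 x))) (A' / enorm3 x * x 0) (A' / enorm3 x * x 1)
      (A' / enorm3 x * x 2) := by
  have hr := enorm3_pos hx
  have hr' : (enorm3 x : ℂ) ≠ 0 := by exact_mod_cast hr.ne'
  have hsq : (enorm3 x : ℂ) ^ 2 = x 0 ^ 2 + x 1 ^ 2 + x 2 ^ 2 := by exact_mod_cast enorm3_sq x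
  unfold Dop
  simp only [pdQ_mk4, pd_radial hx A A' hA, pd_radial_mul hx B B' hB, qi0, qi1, qi2, mk4_mul,
    mk4_add]
  apply mk4_congr
  · simp
    field_simp
    linear_combination B' * hsq
  all_goals
    simp
    field_simp
    try ring

section main
variable (a b : ℝ)

def EE (t : ℝ) : ℂ := Complex.exp (Complex.I * t / (b * a)) / (b * a)
def th (r : ℝ) : ℂ := -Complex.exp (Complex.I * (b : ℂ)⁻¹ * r) / (4 * Real.pi * r)
def s0 (t r : ℝ) : ℂ := (S0 (t * r / (b ^ 2 * a)) : ℝ)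
def s1 (t r : ℝ) : ℂ := (S1 (t * r / (b ^ 2 * a)) : ℝ)
def AA (t r : ℝ) : ℂ :=
  EE a b t * th b r * (s0 a b t r / b + Complex.I * t / (b ^ 2 * a) * s1 a b t r)
def BB (t r : ℝ) : ℂ :=
  EE a b t * th b r * (s0 a b t r * (1 / r ^ 2 - Complex.I / (b * r))
    + t / (b ^ 2 * a) * s1 a b t r / r)
def AAr (t r : ℝ) : ℂ :=
  EE a b t * th b r * ((Complex.I / b - 1 / r) *
    (s0 a b t r / b + Complex.I * t / (b ^ 2 * a) * s1 a b t r)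
    + (- t / (b ^ 2 * a) * s1 a b t r / b
      + Complex.I * t / (b ^ 2 * a) * ((s0 a b t r - s1 a b t r) / r)))
def BBr (t r : ℝ) : ℂ :=
  EE a b t * th b r * ((Complex.I / b - 1 / r) * (s0 a b t r * (1 / r ^ 2 - Complex.I / (b * r))
    + t / (b ^ 2 * a) * s1 a b t r / r)
    + (- t / (b ^ 2 * a) * s1 a b t r * (1 / r ^ 2 - Complex.I / (b * r))
      + s0 a b t r * (-2 / r ^ 3 + Complex.I / (b * r ^ 2))
      + t / (b ^ 2 * a) * ((s0 a b t r - s1 a b t r) / r) / r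
      - t / (b ^ 2 * a) * s1 a b t r / r ^ 2))

variable {a b}

lemma EE_deriv (t : ℝ) : HasDerivAt (EE a b) (EE a b t * (Complex.I / (b * a))) t := by
  have h0 : HasDerivAt (fun t : ℝ => (t : ℂ)) 1 t := Complex.ofRealCLM.hasDerivAt
  have h := (((h0.const_mul Complex.I).div_const ((b : ℂ) * a)).cexp).div_const ((b : ℂ) * a)
  refine HasDerivAt.congr_deriv h ?_
  rw [EE]; ring

lemma th_deriv {r : ℝ} (hr : r ≠ 0) :
    HasDerivAt (th b) (th b r * (Complex.I / b - 1 / r)) r := by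
  have h0 : HasDerivAt (fun t : ℝ => (t : ℂ)) 1 r := Complex.ofRealCLM.hasDerivAt
  have hr' : (r : ℂ) ≠ 0 := by exact_mod_cast hr
  have hpi : (Real.pi : ℂ) ≠ 0 := by exact_mod_cast Real.pi_ne_zero
  have h := (((h0.const_mul (Complex.I * (b : ℂ)⁻¹)).cexp).neg).div
    (h0.const_mul (4 * (Real.pi : ℂ))) (by simp [hr, Real.pi_ne_zero])
  refine HasDerivAt.congr_deriv h ?_
  simp only [Pi.neg_apply]
  rw [th, div_eq_mul_inv Complex.I]
  generalize (b : ℂ)⁻¹ = β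
  field_simp
  ring

lemma inner_r (t r : ℝ) :
    HasDerivAt (fun r => t * r / (b ^ 2 * a)) (t / (b ^ 2 * a)) r := by
  simpa using ((hasDerivAt_id r).const_mul t).div_const (b ^ 2 * a)

lemma inner_t (t r : ℝ) :
    HasDerivAt (fun t => t * r / (b ^ 2 * a)) (r / (b ^ 2 * a)) t := by
  simpa using ((hasDerivAt_id t).mul_const r).div_const (b ^ 2 * a)

lemma s0_r (t r : ℝ) :
    HasDerivAt (fun r => s0 a b t r) (-t / (b ^ 2 * a) * s1 a b t r) r := by
  have h := ((S0_deriv (t * r / (b ^ 2 * a))).comp r (inner_r t r)).ofReal_comp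
  refine HasDerivAt.congr_deriv h ?_
  rw [s1]; push_cast; ring

lemma s0_t (t r : ℝ) :
    HasDerivAt (fun t => s0 a b t r) (-r / (b ^ 2 * a) * s1 a b t r) t := by
  have h := ((S0_deriv (t * r / (b ^ 2 * a))).comp t (inner_t t r)).ofReal_comp
  refine HasDerivAt.congr_deriv h ?_
  rw [s1]; push_cast; ring

lemma s1_r (t : ℝ) {r : ℝ} (hr : r ≠ 0) :
    HasDerivAt (fun r => s1 a b t r) ((s0 a b t r - s1 a b t r) / r) r := by
  obtain ⟨d, hd, he⟩ := S1_deriv (t * r / (b ^ 2 * a))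
  have h := (hd.comp r (inner_r t r)).ofReal_comp
  refine HasDerivAt.congr_deriv h ?_
  rw [s0, s1, ← Complex.ofReal_sub, ← he, ← Complex.ofReal_div]
  congr 1
  field_simp

lemma s1_t {t : ℝ} (ht : t ≠ 0) (r : ℝ) :
    HasDerivAt (fun t => s1 a b t r) ((s0 a b t r - s1 a b t r) / t) t := by
  obtain ⟨d, hd, he⟩ := S1_deriv (t * r / (b ^ 2 * a))
  have h := (hd.comp t (inner_t t r)).ofReal_comp
  refine HasDerivAt.congr_deriv h ?_
  rw [s0, s1, ← Complex.ofReal_sub, ← he, ← Complex.ofReal_div]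
  congr 1
  field_simp

lemma AA_r (t : ℝ) {r : ℝ} (hr : r ≠ 0) : HasDerivAt (AA a b t) (AAr a b t r) r := by
  have h := ((th_deriv (b := b) hr).const_mul (EE a b t)).mul
    (((s0_r (a := a) (b := b) t r).div_const (b : ℂ)).add
      ((s1_r (a := a) (b := b) t hr).const_mul (Complex.I * t / (b ^ 2 * a))))
  refine HasDerivAt.congr_deriv h ?_
  simp only [AAr, Pi.add_apply]
  ring

lemma BB_r (hb : b ≠ 0) (t : ℝ) {r : ℝ} (hr : r ≠ 0) :
    HasDerivAt (BB a b t) (BBr a b t r) r := by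
  have hr' : (r : ℂ) ≠ 0 := by exact_mod_cast hr
  have hb' : (b : ℂ) ≠ 0 := by exact_mod_cast hb
  have h0 : HasDerivAt (fun t : ℝ => (t : ℂ)) 1 r := Complex.ofRealCLM.hasDerivAt
  have h1 : HasDerivAt (fun r : ℝ => 1 / (r : ℂ) ^ 2 - Complex.I / (b * r))
      (-2 / r ^ 3 + Complex.I / (b * r ^ 2)) r := by
    have := (((hasDerivAt_const r (1 : ℂ)).div (h0.pow 2) (by simp [hr]))).sub
      ((hasDerivAt_const r Complex.I).div (h0.const_mul (b : ℂ)) (by simp [hr, hb]))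
    refine HasDerivAt.congr_deriv this ?_
    simp only [Pi.pow_apply]
    field_simp
    ring
  have h := ((th_deriv (b := b) hr).const_mul (EE a b t)).mul
    (((s0_r (a := a) (b := b) t r).mul h1).add
      (((s1_r (a := a) (b := b) t hr).const_mul ((t : ℂ) / (b ^ 2 * a))).div h0 hr'))
  refine HasDerivAt.congr_deriv h ?_
  simp only [BBr, Pi.add_apply, Pi.mul_apply, Pi.div_apply]
  field_simp
  ring

lemma key (hb : b ≠ 0) (ha : a ≠ 0) {t r : ℝ} (ht : t ≠ 0) (hr : r ≠ 0) :
    ∃ dA dB dA' dB' : ℂ, HasDerivAt (fun t => AA a b t r) dA t ∧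
      HasDerivAt (fun t => BB a b t r) dB t ∧ HasDerivAt (fun t => AAr a b t r) dA' t ∧
      HasDerivAt (fun t => BBr a b t r) dB' t ∧
      b * a * (-(r * dB' + 3 * dB)) + a * dA
        - Complex.I * (-(r * BBr a b t r + 3 * BB a b t r)) = 0 ∧
      b * a * (dA' / r) + a * dB - Complex.I * (AAr a b t r / r) = 0 := by
  have hr' : (r : ℂ) ≠ 0 := by exact_mod_cast hr
  have hb' : (b : ℂ) ≠ 0 := by exact_mod_cast hb
  have ha' : (a : ℂ) ≠ 0 := by exact_mod_cast ha
  have ht' : (t : ℂ) ≠ 0 := by exact_mod_cast ht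
  have h0 : HasDerivAt (fun t : ℝ => (t : ℂ)) 1 t := Complex.ofRealCLM.hasDerivAt
  have hE := (EE_deriv (a := a) (b := b) t).mul_const (th b r)
  have hs0 := s0_t (a := a) (b := b) t r
  have hs1 := s1_t (a := a) (b := b) ht r
  have hc : HasDerivAt (fun t : ℝ => (t : ℂ) / (b ^ 2 * a)) (1 / (b ^ 2 * a)) t := h0.div_const _
  have hn : HasDerivAt (fun t : ℝ => -(t : ℂ) / (b ^ 2 * a)) (-1 / (b ^ 2 * a)) t :=
    h0.neg.div_const _
  have hI : HasDerivAt (fun t : ℝ => Complex.I * (t : ℂ) / (b ^ 2 * a))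
    (Complex.I * 1 / (b ^ 2 * a)) t := (h0.const_mul _).div_const _
  have uA := (hs0.div_const (b : ℂ)).add (hI.mul hs1)
  have uB := (hs0.mul_const (1 / (r : ℂ) ^ 2 - Complex.I / (b * r))).add
    ((hc.mul hs1).div_const (r : ℂ))
  have uA' := (uA.const_mul (Complex.I / (b : ℂ) - 1 / r)).add
    (((hn.mul hs1).div_const (b : ℂ)).add (hI.mul ((hs0.sub hs1).div_const (r : ℂ))))
  have uB' := (uB.const_mul (Complex.I / (b : ℂ) - 1 / r)).add
    (((((hn.mul hs1).mul_const (1 / (r : ℂ) ^ 2 - Complex.I / (b * r))).add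
      (hs0.mul_const (-2 / (r : ℂ) ^ 3 + Complex.I / (b * r ^ 2)))).add
      ((hc.mul ((hs0.sub hs1).div_const (r : ℂ))).div_const (r : ℂ))).sub
      ((hc.mul hs1).div_const ((r : ℂ) ^ 2)))
  refine ⟨_, _, _, _, hE.mul uA, hE.mul uB, hE.mul uA', hE.mul uB', ?_, ?_⟩
  · simp only [AA, BB, AAr, BBr, Pi.add_apply, Pi.mul_apply, Pi.sub_apply, Pi.div_apply]
    generalize EE a b t = E
    generalize th b r = θ
    generalize s0 a b t r = σ
    generalize s1 a b t r = τ
    field_simp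
    ring_nf
    try simp only [Complex.I_sq, Complex.I_pow_three]
    try ring
  · simp only [AA, BB, AAr, BBr, Pi.add_apply, Pi.mul_apply, Pi.sub_apply, Pi.div_apply]
    generalize EE a b t = E
    generalize th b r = θ
    generalize s0 a b t r = σ
    generalize s1 a b t r = τ
    field_simp
    ring_nf
    try simp only [Complex.I_sq, Complex.I_pow_three]
    try ring

end main

/-- The fundamental-solution expression
`f(t,x) = (e^{it/(β√(εμ))}/(β√(εμ))) [𝒦_{1/β}(x) S₀(s) + (it/(β²√(εμ))) Θ_{1/β}(x)(1 − i x/|x|) S₁(s)]`,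
with `s = t|x|/(β²√(εμ))`, satisfies `M f = 0` for `t > 0`, `x ≠ 0`. -/
theorem fundamental_solution_in_kernel_of_M
    (ε μ β : ℝ) (hε : 0 < ε) (hμ : 0 < μ) (hβ : β ≠ 0)
    (s : ℝ → V3 → ℝ)
    (hs : s = fun t x => t * enorm3 x / (β ^ 2 * Real.sqrt (ε * μ)))
    (f : ℝ × V3 → BQ)
    (hf : f = fun p =>
      (Complex.exp (Complex.I * (p.1 : ℂ) / ((β * Real.sqrt (ε * μ) : ℝ) : ℂ)) /
          ((β * Real.sqrt (ε * μ) : ℝ) : ℂ)) •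
        (((S0 (s p.1 p.2) : ℝ) : ℂ) • Kfun ((1 / β : ℝ) : ℂ) p.2
          + (Complex.I * (p.1 : ℂ) / ((β ^ 2 * Real.sqrt (ε * μ) : ℝ) : ℂ)
              * Theta ((1 / β : ℝ) : ℂ) p.2 * ((S1 (s p.1 p.2) : ℝ) : ℂ)) •
            (1 - (Complex.I * ((enorm3 p.2 : ℝ) : ℂ)⁻¹) • vecR p.2))) :
    ∀ t : ℝ, 0 < t → ∀ x : V3, x ≠ 0 → Mop ε μ β f (t, x) = 0 := by

  intro t ht x hx
  set a := Real.sqrt (ε * μ) with ha_def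
  have ha : a ≠ 0 := (Real.sqrt_pos.2 (mul_pos hε hμ)).ne'
  have hf' : f = fun p => mk4 (AA a β p.1 (enorm3 p.2)) (BB a β p.1 (enorm3 p.2) * (p.2 0 : ℂ))
      (BB a β p.1 (enorm3 p.2) * (p.2 1 : ℂ)) (BB a β p.1 (enorm3 p.2) * (p.2 2 : ℂ)) := by
    rw [hf, hs]
    funext p
    have hI : Complex.I ^ 2 = -1 := Complex.I_sq
    simp only [Kfun, mk4_one, mk4_coe, mk4_vecR, mk4_add, mk4_sub, mk4_smul]
    apply mk4_congr
    · simp [AA, EE, th, s0, s1, Theta]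
      ring
    all_goals
      simp [BB, EE, th, s0, s1, Theta]
      ring_nf
      try simp only [Complex.I_sq]
      try ring
  clear hf
  have hr := (enorm3_pos hx).ne'
  have hD : ∀ u : ℝ, DQ f (u, x) =
      mk4 (-(enorm3 x * BBr a β u (enorm3 x) + 3 * BB a β u (enorm3 x)))
      (AAr a β u (enorm3 x) / enorm3 x * x 0) (AAr a β u (enorm3 x) / enorm3 x * x 1)
      (AAr a β u (enorm3 x) / enorm3 x * x 2) := by
    intro u
    rw [hf']
    exact Dop_radial hx (AA a β u) (BB a β u) _ _ (AA_r u hr) (BB_r hβ u hr)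
  obtain ⟨dA, dB, dA', dB', hA, hB, hA', hB', e1, e2⟩ := key hβ ha ht.ne' hr
  have hre := (((hB'.const_mul (enorm3 x : ℂ)).add (hB.const_mul 3)).neg).deriv
  have him : ∀ k : Fin 3, _ := fun k =>
    ((hA'.div_const (enorm3 x : ℂ)).mul_const (x k : ℂ)).deriv
  have hbm : ∀ k : Fin 3, _ := fun k => (hB.mul_const (x k : ℂ)).deriv
  have p1 : ptQ (DQ f) (t, x) = mk4 (-(enorm3 x * dB' + 3 * dB)) (dA' / enorm3 x * x 0)
      (dA' / enorm3 x * x 1) (dA' / enorm3 x * x 2) := by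
    simp only [ptQ, hD]
    apply mk4_congr
    · exact hre
    · exact him 0
    · exact him 1
    · exact him 2
  have p2 : ptQ f (t, x) = mk4 dA (dB * x 0) (dB * x 1) (dB * x 2) := by
    simp only [ptQ, hf']
    apply mk4_congr
    · exact hA.deriv
    · exact hbm 0
    · exact hbm 1
    · exact hbm 2
  rw [Mop, p1, p2, hD, ← ha_def]
  simp only [mk4_zero, mk4_add, mk4_sub, mk4_smul]
  apply mk4_congr
  · simp
    linear_combination e1
  · simp
    linear_combination (x 0 : ℂ) * e2
  · simp
    linear_combination (x 1 : ℂ) * e2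
  · simp
    linear_combination (x 2 : ℂ) * e2
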